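/- Let X be a finite connected poset and f : X → ℝ order preserving. Define x ∼ y iff there exists a poset path γ from x to y with f(z) ≥ max(f(x), f(y)) for all z in γ, and define [x] ≤ [y] on the quotient T_f(X) iff there is a poset path γ from x to y with f(z) ≥ f(x) for all z ∈ γ. Then (T_f(X), ≤) is a tree poset: any two elements below a common element are comparable. -/

import Mathlib

open scoped Classical

namespace ReebPoset

variable {X : Type*}

/-- Two elements of a poset are comparable. -/
def Cmp [PartialOrder X] (a b : X) : Prop := a ≤ b ∨ b ≤ a

/-- A poset path from `x` to `y`: a finite sequence of consecutively comparable elements. -/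
structure Path [PartialOrder X] (x y : X) where
  n : ℕ
  pts : Fin (n + 1) → X
  first : pts 0 = x
  last : pts (Fin.last n) = y
  step : ∀ i : Fin n, Cmp (pts i.castSucc) (pts i.succ)

/-- A poset is connected if any two points are joined by a poset path. -/
def Connected (X : Type*) [PartialOrder X] : Prop := ∀ x y : X, Nonempty (Path x y)

/-- The `f`-length of a poset path. -/
noncomputable def flen [PartialOrder X] (f : X → ℝ) {x y : X} (γ : Path x y) : ℝ :=
  ∑ i : Fin γ.n, |f (γ.pts i.succ) - f (γ.pts i.castSucc)|

/-- The metric induced by the filtration `f` (the Reeb metric). -/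
noncomputable def df [PartialOrder X] (f : X → ℝ) (x y : X) : ℝ :=
  sInf {L | ∃ γ : Path x y, L = flen f γ}

/-- The Gromov product associated to `f`. -/
noncomputable def gf [PartialOrder X] (f : X → ℝ) (x y : X) : ℝ :=
  (f x + f y - df f x y) / 2

/-- The poset hyperbolicity of `(X, f)`. -/
noncomputable def hypf (X : Type*) [PartialOrder X] (f : X → ℝ) : ℝ :=
  sInf {ε : ℝ | 0 ≤ ε ∧ ∀ x y z : X, gf f x z ≥ min (gf f x y) (gf f y z) - ε}

/-- The merge value `m_f(x,y)`: max over poset paths of the min of `f` along the path. -/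
noncomputable def mf [PartialOrder X] (f : X → ℝ) (x y : X) : ℝ :=
  sSup {m | ∃ γ : Path x y,
    m = Finset.univ.inf' Finset.univ_nonempty (fun i : Fin (γ.n + 1) => f (γ.pts i))}

/-- A poset path is a fence if its points are distinct and non-consecutive points
are incomparable. -/
def IsFence [PartialOrder X] {x y : X} (γ : Path x y) : Prop :=
  Function.Injective γ.pts ∧
  ∀ i j : Fin (γ.n + 1), (i : ℕ) + 2 ≤ (j : ℕ) → ¬ Cmp (γ.pts i) (γ.pts j)

/-- The maximal length of a fence in the poset `X`. -/
noncomputable def MF (X : Type*) [PartialOrder X] : ℕ :=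
  sSup {n : ℕ | ∃ x y : X, ∃ γ : Path x y, IsFence γ ∧ γ.n = n}

/-- A merging point: an element covering at least two distinct elements. -/
def Merging [PartialOrder X] (x : X) : Prop := ∃ y z : X, y ≠ z ∧ y ⋖ x ∧ z ⋖ x

/-- A poset is a tree if every down-set is a chain. -/
def IsTreePoset (X : Type*) [PartialOrder X] : Prop :=
  ∀ a b c : X, a ≤ c → b ≤ c → (a ≤ b ∨ b ≤ a)

/-- The covering graph of a poset. -/
def covGraph (X : Type*) [PartialOrder X] : SimpleGraph X :=
  SimpleGraph.fromRel (fun a b => a ⋖ b)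

/-- The number of elements covered by `x`. -/
noncomputable def iota [PartialOrder X] [Fintype X] (x : X) : ℕ :=
  (Finset.univ.filter (fun y => y ⋖ x)).card

/-- The first Betti number of a graph: the minimal number of edges one needs to remove
to obtain a tree. -/
noncomputable def betti (G : SimpleGraph X) : ℕ :=
  sInf {k | ∃ s : Set (Sym2 X), s.ncard = k ∧ (G.deleteEdges s).IsTree}

/-- `x ∼ y` iff some poset path from `x` to `y` is `f`-constant. -/
def constRel [PartialOrder X] (f : X → ℝ) (x y : X) : Prop :=
  ∃ γ : Path x y, ∀ i : Fin (γ.n + 1), f (γ.pts i) = f x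

/-- `[x] ≤ [y]` in the Reeb poset iff some poset path from `x` to `y` is `f`-nondecreasing. -/
def ndRel [PartialOrder X] (f : X → ℝ) (x y : X) : Prop :=
  ∃ γ : Path x y, ∀ i : Fin γ.n, f (γ.pts i.castSucc) ≤ f (γ.pts i.succ)

/-- `x ∼ y` in the Reeb tree construction: some poset path from `x` to `y` has all
`f`-values at least `max (f x) (f y)`. -/
def treeEq [PartialOrder X] (f : X → ℝ) (x y : X) : Prop :=
  ∃ γ : Path x y, ∀ i : Fin (γ.n + 1), max (f x) (f y) ≤ f (γ.pts i)

/-- `[x] ≤ [y]` in the Reeb tree poset: some poset path from `x` to `y` has all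
`f`-values at least `f x`. -/
def treeLe [PartialOrder X] (f : X → ℝ) (x y : X) : Prop :=
  ∃ γ : Path x y, ∀ i : Fin (γ.n + 1), f x ≤ f (γ.pts i)

end ReebPoset

namespace ReebPoset

theorem Cmp.symm {X : Type*} [PartialOrder X] {a b : X} (h : Cmp a b) : Cmp b a := Or.symm h

/-- A poset path within a set `S` amounts to a chain of comparabilities inside `S`. -/
theorem exists_path_forall_mem_iff {X : Type*} [PartialOrder X] {S : Set X} {x y : X} :
    (∃ γ : Path x y, ∀ i, γ.pts i ∈ S) ↔
      x ∈ S ∧ Relation.ReflTransGen (fun a b => Cmp a b ∧ a ∈ S ∧ b ∈ S) x y := by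
  constructor
  · rintro ⟨⟨n, p, rfl, rfl, step⟩, hS⟩
    have reach (i : Fin (n + 1)) :
        Relation.ReflTransGen (fun a b => Cmp a b ∧ a ∈ S ∧ b ∈ S) (p 0) (p i) := by
      induction i using Fin.induction with
      | zero => exact .refl
      | succ i ih => exact ih.tail ⟨step i, hS _, hS _⟩
    exact ⟨hS 0, reach _⟩
  · rintro ⟨hx, h⟩
    induction h with
    | refl => exact ⟨⟨0, fun _ => x, rfl, rfl, fun i => i.elim0⟩, fun _ => hx⟩
    | @tail b c _ hbc ih =>
      obtain ⟨⟨n, p, first, last, step⟩, hS⟩ := ih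
      refine ⟨⟨n + 1, Fin.snoc p c, ?_, Fin.snoc_last _ _, fun i => ?_⟩, fun i => ?_⟩
      · rw [← Fin.castSucc_zero, Fin.snoc_castSucc, first]
      · induction i using Fin.lastCases with
        | last =>
          rw [Fin.snoc_castSucc, Fin.succ_last, Fin.snoc_last, last]
          exact hbc.1
        | cast i =>
          rw [Fin.snoc_castSucc, Fin.succ_castSucc, Fin.snoc_castSucc]
          exact step i
      · induction i using Fin.lastCases with
        | last => simpa using hbc.2.2
        | cast i => simpa using hS i

theorem treeLe_iff {X : Type*} [PartialOrder X] {f : X → ℝ} {x y : X} :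
    treeLe f x y ↔
      Relation.ReflTransGen (fun a b => Cmp a b ∧ f x ≤ f a ∧ f x ≤ f b) x y :=
  (exists_path_forall_mem_iff (S := {a | f x ≤ f a})).trans (and_iff_right (le_refl (f x)))

/-- Two elements below a common one are related, from the one of smaller value. -/
theorem treeLe_of_le {X : Type*} [PartialOrder X] {f : X → ℝ} {x y z : X}
    (hx : treeLe f x z) (hy : treeLe f y z) (hxy : f x ≤ f y) : treeLe f x y := by
  rw [treeLe_iff] at *
  refine hx.trans (Relation.ReflTransGen.mono ?_ z y hy.swap)
  exact fun a b h => ⟨h.1.symm, hxy.trans h.2.2, hxy.trans h.2.1⟩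

end ReebPoset

open ReebPoset in
/-- the Reeb tree quotient `T_f(X)` is a tree poset: any two classes
below a common class are comparable. -/
theorem stmt11 {X : Type*} [PartialOrder X] [Fintype X]
    (hc : Connected X) (f : X → ℝ) (hm : Monotone f) :
    ∀ x y z : X, treeLe f x z → treeLe f y z → (treeLe f x y ∨ treeLe f y x) :=
  fun x y _ hx hy => (le_total (f x) (f y)).imp (treeLe_of_le hx hy) (treeLe_of_le hy hx)
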